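/- Let k and d be positive integers with 2k > d, and let M, v, c > 0. Then there exists a constant K > 0, depending only on k, d, M, v, c, such that for every ε ∈ (0,1) there exist an integer m ≥ 1 and positive integers N_1,…,N_m satisfying both: (i) M^2 · 2^{−2km} + Σ_{i=1}^m v · 2^{−2ki} / N_i ≤ ε^2, and (ii) Σ_{i=1}^m N_i · c · 2^{di} ≤ K · ε^{−2}. -/

import Mathlib

theorem sum_range_pow_succ_le_div {q : ℝ} (hq₀ : 0 ≤ q) (hq₁ : q < 1) (m : ℕ) :
    ∑ i ∈ Finset.range m, q ^ (i + 1) ≤ q / (1 - q) := by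
  have h : (0 : ℝ) < 1 - q := sub_pos.2 hq₁
  have key : (∑ i ∈ Finset.range m, q ^ (i + 1)) * (1 - q) = q * (1 - q ^ m) := by
    simp_rw [pow_succ]
    rw [← Finset.sum_mul, mul_right_comm, geom_sum_mul_neg, mul_comm]
  rw [le_div_iff₀ h, key]
  exact mul_le_of_le_one_right hq₀ (sub_le_self 1 (pow_nonneg hq₀ m))

theorem sum_range_pow_succ_le_two_mul_pow {D : ℝ} (hD : 2 ≤ D) (m : ℕ) :
    ∑ i ∈ Finset.range m, D ^ (i + 1) ≤ 2 * D ^ m := by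
  induction m with
  | zero => simp
  | succ n ih =>
    rw [Finset.sum_range_succ, pow_succ]
    nlinarith [pow_nonneg (by linarith : (0 : ℝ) ≤ D) n]

/-- Arithmetic core of the MLMC complexity theorem (Proposition 1): with bias
bounded by `M² 2^{-2km}`, level-`i` variance bounded by `v 2^{-2ki}` and
level-`i` sample cost `c 2^{di}` (with `2k > d`), for every `ε ∈ (0,1)` one can
choose a number of levels `m` and samples `N i` per level so that the MSE is at
most `ε²` while the total cost is `O(ε⁻²)`. -/
theorem mlmc_complexity
    (k d : ℕ) (hk : 0 < k) (hd : 0 < d) (hkd : d < 2 * k)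
    (M v c : ℝ) (hM : 0 < M) (hv : 0 < v) (hc : 0 < c) :
    ∃ K : ℝ, 0 < K ∧
      ∀ ε : ℝ, ε ∈ Set.Ioo (0 : ℝ) 1 →
        ∃ (m : ℕ) (N : Fin m → ℕ), 1 ≤ m ∧ (∀ i, 0 < N i) ∧
          M ^ 2 * ((2 : ℝ) ^ (2 * k * m))⁻¹
              + ∑ i : Fin m, v * ((2 : ℝ) ^ (2 * k * (i.1 + 1)))⁻¹ / (N i : ℝ)
            ≤ ε ^ 2 ∧
          ∑ i : Fin m, (N i : ℝ) * (c * (2 : ℝ) ^ (d * (i.1 + 1)))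
            ≤ K * (ε ^ 2)⁻¹ := by
  have hD : (2 : ℝ) ≤ 2 ^ d := le_self_pow₀ one_le_two hd.ne'
  have hDB : (2 : ℝ) ^ d * 2 ≤ 2 ^ (2 * k) := by
    rw [← pow_succ]
    exact pow_le_pow_right₀ one_le_two hkd
  simp_rw [pow_mul (2 : ℝ) (2 * k), pow_mul (2 : ℝ) d]
  generalize (2 : ℝ) ^ (2 * k) = B at *
  generalize (2 : ℝ) ^ d = D at *
  have hD₀ : 0 < D := by linarith
  have hB₀ : 0 < B := by linarith
  refine ⟨c * (12 * v + 2 * (B * (1 + 2 * M ^ 2))), by positivity, ?_⟩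
  rintro ε ⟨hε₀, hε₁⟩
  have hE : 0 < ε ^ 2 := by positivity
  have hE₁ : 1 ≤ (ε ^ 2)⁻¹ := (one_le_inv₀ hE).2 (pow_le_one₀ hε₀.le hε₁.le)
  generalize ε ^ 2 = E at *
  obtain ⟨n, hn, hn'⟩ := exists_nat_pow_near (x := 1 + 2 * M ^ 2 * E⁻¹) (y := B)
    (le_add_of_nonneg_right (by positivity)) (by linarith)
  have hBm : B ^ (n + 1) ≤ B * (1 + 2 * M ^ 2) * E⁻¹ := by
    rw [pow_succ', mul_assoc]
    gcongr
    nlinarith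
  let w : ℕ → ℝ := fun i ↦ 4 * v * E⁻¹ * ((3 / 4) ^ (i + 1) / D ^ (i + 1))
  have hw : ∀ i, 0 < w i := fun i ↦ by positivity
  refine ⟨n + 1, fun i ↦ ⌈w i⌉₊, by lia, fun i ↦ Nat.ceil_pos.2 (hw i), ?_, ?_⟩
  · have hbias : M ^ 2 * (B ^ (n + 1))⁻¹ ≤ E / 2 := by
      rw [← div_eq_mul_inv, div_le_iff₀ (by positivity)]
      calc M ^ 2 = E / 2 * (2 * M ^ 2 * E⁻¹) := by field_simp
        _ ≤ E / 2 * B ^ (n + 1) := by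
          gcongr
          linarith
    have hvar : ∀ i : ℕ, v * (B ^ (i + 1))⁻¹ / (⌈w i⌉₊ : ℝ) ≤ E / 4 * (2 / 3) ^ (i + 1) := by
      intro i
      calc v * (B ^ (i + 1))⁻¹ / (⌈w i⌉₊ : ℝ)
          ≤ v * ((D * 2) ^ (i + 1))⁻¹ / w i := by
            have := hw i
            gcongr
            exact Nat.le_ceil _
        _ = E / 4 * (2 / 3) ^ (i + 1) := by
            have h : (2 / 3 : ℝ) ^ (i + 1) = (2 ^ (i + 1))⁻¹ / (3 / 4) ^ (i + 1) := by
              rw [← inv_pow, ← div_pow]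
              norm_num
            simp only [w]
            rw [h, mul_pow]
            field_simp
    have hsum := sum_range_pow_succ_le_div (q := 2 / 3) (by norm_num) (by norm_num) (n + 1)
    have hvarSum : ∑ i : Fin (n + 1), v * (B ^ (i.1 + 1))⁻¹ / (⌈w i⌉₊ : ℝ) ≤ E / 2 := by
      rw [Fin.sum_univ_eq_sum_range (fun i ↦ v * (B ^ (i + 1))⁻¹ / (⌈w i⌉₊ : ℝ))]
      refine (Finset.sum_le_sum fun i _ ↦ hvar i).trans ?_
      rw [← Finset.mul_sum]
      norm_num at hsum
      nlinarith
    linarith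
  · have hcost : ∀ i : ℕ, (⌈w i⌉₊ : ℝ) * (c * D ^ (i + 1)) ≤
        c * (4 * v * E⁻¹ * (3 / 4) ^ (i + 1) + D ^ (i + 1)) := by
      intro i
      calc (⌈w i⌉₊ : ℝ) * (c * D ^ (i + 1)) ≤ (w i + 1) * (c * D ^ (i + 1)) := by
            gcongr
            exact (Nat.ceil_lt_add_one (hw i).le).le
        _ = c * (4 * v * E⁻¹ * (3 / 4) ^ (i + 1) + D ^ (i + 1)) := by
            simp only [w]
            field_simp
    rw [Fin.sum_univ_eq_sum_range (fun i ↦ (⌈w i⌉₊ : ℝ) * (c * D ^ (i + 1)))]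
    refine (Finset.sum_le_sum fun i _ ↦ hcost i).trans ?_
    rw [← Finset.mul_sum, Finset.sum_add_distrib, ← Finset.mul_sum, mul_assoc c]
    have hsum : ∑ i ∈ Finset.range (n + 1), (3 / 4 : ℝ) ^ (i + 1) ≤ 3 :=
      (sum_range_pow_succ_le_div (by norm_num) (by norm_num) _).trans (by norm_num)
    have hDB' : D ^ (n + 1) ≤ B ^ (n + 1) := pow_le_pow_left₀ hD₀.le (by linarith) _
    gcongr
    calc _ ≤ 4 * v * E⁻¹ * 3 + 2 * D ^ (n + 1) := by
          gcongr
          exact sum_range_pow_succ_le_two_mul_pow hD _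
      _ ≤ 4 * v * E⁻¹ * 3 + 2 * (B * (1 + 2 * M ^ 2) * E⁻¹) := by
          gcongr
          exact hDB'.trans hBm
      _ = (12 * v + 2 * (B * (1 + 2 * M ^ 2))) * E⁻¹ := by ring
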